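/- Two elements f, g of PSL(2,ℤ) commute if and only if they are both powers of a common element h ∈ PSL(2,ℤ). -/

import Mathlib

/-- The modular group `PSL(2,ℤ)`, the quotient of `SL(2,ℤ)` by its center `{±1}`. -/
abbrev PSL2Z := Matrix.SpecialLinearGroup (Fin 2) ℤ ⧸
  Subgroup.center (Matrix.SpecialLinearGroup (Fin 2) ℤ)

/-- Two elements of a group are powers of a common element. -/
def PowersOfCommon {G : Type*} [Group G] (x y : G) : Prop :=
  ∃ h : G, ∃ m n : ℤ, x = h ^ m ∧ y = h ^ n

namespace PowersOfCommon

variable {G : Type*} [Group G] {x y : G}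

theorem symm (h : PowersOfCommon x y) : PowersOfCommon y x := by
  obtain ⟨h, m, n, hx, hy⟩ := h
  exact ⟨h, n, m, hy, hx⟩

theorem one_right (x : G) : PowersOfCommon x 1 :=
  ⟨x, 1, 0, by simp, by simp⟩

theorem of_mul_left (h : PowersOfCommon (x * y) y) : PowersOfCommon x y := by
  obtain ⟨h, m, n, hx, hy⟩ := h
  exact ⟨h, m - n, n, by rw [zpow_sub, ← hx, ← hy, mul_inv_cancel_right], hy⟩

theorem of_mul_inv_left (h : PowersOfCommon (x * y⁻¹) y) : PowersOfCommon x y := by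
  obtain ⟨h, m, n, hx, hy⟩ := h
  exact ⟨h, m + n, n, by rw [zpow_add, ← hx, ← hy, inv_mul_cancel_right], hy⟩

end PowersOfCommon

namespace Matrix.SpecialLinearGroup

local notation "SL2Z" => Matrix.SpecialLinearGroup (Fin 2) ℤ

theorem mul_entries (A B : SL2Z) :
    (A * B) 0 0 = A 0 0 * B 0 0 + A 0 1 * B 1 0 ∧ (A * B) 0 1 = A 0 0 * B 0 1 + A 0 1 * B 1 1 ∧
    (A * B) 1 0 = A 1 0 * B 0 0 + A 1 1 * B 1 0 ∧ (A * B) 1 1 = A 1 0 * B 0 1 + A 1 1 * B 1 1 := by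
  simp [Matrix.mul_apply, Fin.sum_univ_two]

theorem det_entries (A : SL2Z) : A 0 0 * A 1 1 - A 0 1 * A 1 0 = 1 := by
  rw [← Matrix.det_fin_two]
  exact A.det_coe

theorem mem_center_of_entries {A : SL2Z} (h01 : A 0 1 = 0) (h10 : A 1 0 = 0)
    (h : A 0 0 = A 1 1) : A ∈ Subgroup.center SL2Z := by
  refine mem_center_iff.2 ⟨A 0 0, ?_, ?_⟩
  · have := det_entries A
    rw [h01, ← h] at this
    simp only [Fintype.card_fin]
    linarith
  · rw [scalar_apply]
    ext i j
    fin_cases i <;> fin_cases j <;> simp [h01, h10, h]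

theorem mem_center_of_diagonal {A : SL2Z} (h01 : A 0 1 = 0) (h10 : A 1 0 = 0) :
    A ∈ Subgroup.center SL2Z := by
  refine mem_center_of_entries h01 h10 ?_
  have hd := det_entries A
  rw [h01, zero_mul, sub_zero] at hd
  exact Int.eq_of_mul_eq_one hd

/-- Commuting matrices have proportional vectors `(A₀₁, A₁₀, A₀₀ - A₁₁)`. -/
theorem proportional_of_commute {A B : SL2Z} (h : Commute A B) :
    A 0 1 * B 1 0 = B 0 1 * A 1 0 ∧
    (A 0 0 - A 1 1) * B 0 1 = (B 0 0 - B 1 1) * A 0 1 ∧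
    (A 0 0 - A 1 1) * B 1 0 = (B 0 0 - B 1 1) * A 1 0 := by
  obtain ⟨h1, h2, h3, -⟩ := mul_entries A B
  obtain ⟨k1, k2, k3, -⟩ := mul_entries B A
  rw [h.eq] at h1 h2 h3
  refine ⟨?_, ?_, ?_⟩ <;> linarith

theorem mem_center_of_commute {A B : SL2Z} (h : Commute A B) {i j : Fin 2} (hij : i ≠ j)
    (hA : A i j ≠ 0) (hB : B i j = 0) : B ∈ Subgroup.center SL2Z := by
  obtain ⟨h1, h2, h3⟩ := proportional_of_commute h
  fin_cases i <;> fin_cases j <;> simp at hij hA hB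
  · rw [hB] at h1 h2
    simp [hA] at h1 h2
    exact mem_center_of_entries hB h1 (by linarith)
  · rw [hB] at h1 h3
    simp [hA] at h1 h3
    exact mem_center_of_entries h1 hB (by linarith)

/-- The identity `sinh (x + y) * sinh (x - y) = sinh x ^ 2 - sinh y ^ 2` for commuting matrices. -/
theorem mul_apply_mul_mul_inv_apply {A B : SL2Z} (h : Commute A B) {i j : Fin 2} (hij : i ≠ j) :
    (A * B) i j * (A * B⁻¹) i j = A i j ^ 2 - B i j ^ 2 := by
  obtain ⟨h1, h2, h3⟩ := proportional_of_commute h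
  obtain ⟨-, p01, p10, -⟩ := mul_entries A B
  obtain ⟨-, q01, q10, -⟩ := mul_entries A B⁻¹
  have hA := det_entries A
  have hB := det_entries B
  have i00 : B⁻¹ 0 0 = B 1 1 := by simp [SL2_inv_expl]
  have i01 : B⁻¹ 0 1 = -B 0 1 := by simp [SL2_inv_expl]
  have i10 : B⁻¹ 1 0 = -B 1 0 := by simp [SL2_inv_expl]
  have i11 : B⁻¹ 1 1 = B 0 0 := by simp [SL2_inv_expl]
  rw [i01, i11] at q01
  rw [i00, i10] at q10
  fin_cases i <;> fin_cases j <;> simp only [Fin.zero_eta, Fin.mk_one, ne_eq, not_true] at hij ⊢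
  · rw [p01, q01]
    linear_combination A 0 1 ^ 2 * hB - B 0 1 ^ 2 * hA - A 0 0 * B 0 1 * h2 +
      A 0 1 * B 0 1 * h1
  · rw [p10, q10]
    linear_combination A 1 0 ^ 2 * hB - B 1 0 ^ 2 * hA + A 1 1 * B 1 0 * h3 -
      A 1 0 * B 1 0 * h1

theorem exists_natAbs_apply_lt {A B : SL2Z} (h : Commute A B) {i j : Fin 2} (hij : i ≠ j)
    (hB : B i j ≠ 0) (hle : (B i j).natAbs ≤ (A i j).natAbs) :
    ((A * B) i j).natAbs < (A i j).natAbs ∨ ((A * B⁻¹) i j).natAbs < (A i j).natAbs := by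
  have key := mul_apply_mul_mul_inv_apply h hij
  generalize A i j = x, B i j = y, (A * B) i j = p, (A * B⁻¹) i j = q at *
  by_contra! hcon
  have hmul := Nat.mul_le_mul hcon.1 hcon.2
  rw [← Int.natAbs_mul, ← Int.natAbs_mul, key] at hmul
  have hsq : y ^ 2 ≤ x ^ 2 := Int.natAbs_le_iff_sq_le.1 hle
  have hpos : 0 < y ^ 2 := by positivity
  have hx : 0 ≤ x * x := mul_self_nonneg x
  have : x * x ≤ x ^ 2 - y ^ 2 := by omega
  linarith

theorem powersOfCommon_mk_of_commute {i j : Fin 2} (hij : i ≠ j) (A B : SL2Z) (h : Commute A B)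
    (hne : A i j ≠ 0 ∨ B i j ≠ 0) : PowersOfCommon (A : PSL2Z) (B : PSL2Z) := by
  induction hn : (A i j).natAbs + (B i j).natAbs using Nat.strong_induction_on
    generalizing A B with
  | _ n ih =>
  wlog hle : (B i j).natAbs ≤ (A i j).natAbs generalizing A B
  · exact (this B A h.symm hne.symm (by omega) (by omega)).symm
  by_cases hB : B i j = 0
  · have hmem := mem_center_of_commute h hij (hne.resolve_right (by simpa using hB)) hB
    rw [(QuotientGroup.eq_one_iff B).2 hmem]
    exact .one_right _
  · rcases exists_natAbs_apply_lt h hij hB hle with hlt | hlt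
    · exact .of_mul_left <| ih _ (by omega) (A * B) B (h.mul_left rfl) (.inr hB) rfl
    · exact .of_mul_inv_left <|
        ih _ (by omega) (A * B⁻¹) B (h.mul_left (Commute.refl B).inv_left) (.inr hB) rfl

theorem not_anticommute {A B : SL2Z} :
    ¬ ((B * A : SL2Z) : Matrix (Fin 2) (Fin 2) ℤ) = -(A * B : SL2Z) := by
  intro h
  obtain ⟨p00, p01, p10, p11⟩ := mul_entries A B
  obtain ⟨q00, q01, q10, q11⟩ := mul_entries B A
  have e (i j : Fin 2) : (B * A) i j = -(A * B) i j := congrFun (congrFun h i) j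
  rw [e] at q00 q01 q10 q11
  rw [p00] at q00
  rw [p01] at q01
  rw [p10] at q10
  rw [p11] at q11
  have hA := det_entries A
  have hB := det_entries B
  generalize A 0 0 = a, A 0 1 = b, A 1 0 = c, A 1 1 = d, B 0 0 = a', B 0 1 = b',
    B 1 0 = c', B 1 1 = d' at *
  have htA : a + d = 0 := by
    have : 2 * (a + d) = 0 := by
      linear_combination (-2 * (a + d)) * hB - d' * q00 + c' * q01 + b' * q10 - a' * q11
    linarith
  have htB : a' + d' = 0 := by
    have : 2 * (a' + d') = 0 := by
      linear_combination (-2 * (a' + d')) * hA - d * q00 + c * q01 + b * q10 - a * q11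
    linarith
  obtain rfl : d = -a := by linarith
  obtain rfl : d' = -a' := by linarith
  have : (b * c' - b' * c) ^ 2 = 4 * a ^ 2 * a' ^ 2 - 4 * (1 + a ^ 2) * (1 + a' ^ 2) := by
    have h1 : b * c = -(1 + a ^ 2) := by linarith
    have h2 : b' * c' = -(1 + a' ^ 2) := by linarith
    have h3 : b * c' + b' * c = -2 * a * a' := by linarith
    linear_combination (b * c' + b' * c - 2 * a * a') * h3 - 4 * b' * c' * h1 +
      4 * (1 + a ^ 2) * h2
  nlinarith [sq_nonneg (b * c' - b' * c), sq_nonneg a, sq_nonneg a']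

theorem commute_of_commute_mk {A B : SL2Z} (h : Commute (A : PSL2Z) (B : PSL2Z)) :
    Commute A B := by
  have hmem : (A * B)⁻¹ * (B * A) ∈ Subgroup.center SL2Z := QuotientGroup.eq.1 h.eq
  obtain ⟨r, hr, hr'⟩ := mem_center_iff.1 hmem
  have hBA : ((B * A : SL2Z) : Matrix (Fin 2) (Fin 2) ℤ) = (A * B : SL2Z) * scalar (Fin 2) r := by
    rw [hr', ← coe_mul, mul_inv_cancel_left]
  rw [Fintype.card_fin, sq_eq_one_iff] at hr
  rcases hr with rfl | rfl
  · rw [map_one, mul_one] at hBA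
    exact (Subtype.ext hBA).symm
  · rw [map_neg, map_one, mul_neg_one] at hBA
    exact (not_anticommute hBA).elim

end Matrix.SpecialLinearGroup

/-- Two elements of `PSL(2,ℤ)` commute if and only if they are both powers of a
common element. -/
theorem commute_iff_powers_of_common (f g : PSL2Z) :
    Commute f g ↔ ∃ h : PSL2Z, ∃ m n : ℤ, f = h ^ m ∧ g = h ^ n := by
  constructor
  · intro h
    obtain ⟨A, rfl⟩ := QuotientGroup.mk_surjective f
    obtain ⟨B, rfl⟩ := QuotientGroup.mk_surjective g
    have hAB := Matrix.SpecialLinearGroup.commute_of_commute_mk h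
    by_cases h01 : A 0 1 ≠ 0 ∨ B 0 1 ≠ 0
    · exact Matrix.SpecialLinearGroup.powersOfCommon_mk_of_commute zero_ne_one A B hAB h01
    by_cases h10 : A 1 0 ≠ 0 ∨ B 1 0 ≠ 0
    · exact Matrix.SpecialLinearGroup.powersOfCommon_mk_of_commute one_ne_zero A B hAB h10
    push Not at h01 h10
    have hB := Matrix.SpecialLinearGroup.mem_center_of_diagonal h01.2 h10.2
    rw [(QuotientGroup.eq_one_iff B).2 hB]
    exact PowersOfCommon.one_right _
  · rintro ⟨h, m, n, rfl, rfl⟩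
    exact Commute.zpow_zpow_self h m n
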